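/- Let m > 0 be a real number and n ≥ 3 an integer. There exists a constant C > 0 depending only on m and n such that for every ε ∈ (0,1] and every τ ∈ (0, c(m,n)·ε²], one has ∫_{A⁺_ε} |∇w_{0,τ}|² dx dt ≤ C · ε^{2−n−2m} · τ^{(n−1)/(2(m+n−1)) + m + (n−3)/2}, where A⁺_ε = {(x,t) ∈ ℝⁿ₊ : ε ≤ |(x,t)| ≤ 2ε} is the half-annulus of radii ε and 2ε. -/

import Mathlib

open MeasureTheory Real

noncomputable section

/-- The constant `c(m,n) = (m+n−1)/(m(m+n−2)²)`. -/
def cmn (m : ℝ) (n : ℕ) : ℝ := (m + n - 1) / (m * (m + n - 2) ^ 2)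

/-- The model function
`w_{x₀,τ}(x,t) = τ^{−(n−1)(m+n−2)/(4(m+n−1))}
  [(1 + (c(m,n)/τ)^{1/2} t)² + c(m,n)|x−x₀|²/τ]^{−(m+n−2)/2}`. -/
def wModel (m : ℝ) (n : ℕ) (x₀ : EuclideanSpace ℝ (Fin (n - 1))) (τ : ℝ)
    (p : EuclideanSpace ℝ (Fin (n - 1)) × ℝ) : ℝ :=
  τ ^ (-(((n : ℝ) - 1) * (m + n - 2)) / (4 * (m + n - 1))) *
    ((1 + (cmn m n / τ) ^ ((1 : ℝ) / 2) * p.2) ^ 2 + cmn m n * ‖p.1 - x₀‖ ^ 2 / τ) ^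
      (-((m + n - 2) / 2))

lemma grad_bound_aux {E : Type*} [NormedAddCommGroup E] [InnerProductSpace ℝ E]
    (A k a ρ : ℝ) (hk : 0 < k) (ha : 0 < a) (hρ : 0 < ρ) (p : E × ℝ)
    (hp : 0 ≤ p.2) (hpρ : ρ ^ 2 ≤ ‖p.1‖ ^ 2 + p.2 ^ 2) :
    ‖fderiv ℝ (fun p : E × ℝ => A * ((1 + k * p.2) ^ 2 + k ^ 2 * ‖p.1‖ ^ 2) ^ (-(a / 2))) p‖ ^ 2
      ≤ 4 * a ^ 2 * A ^ 2 * k ^ 2 * (k ^ 2 * ρ ^ 2) ^ (-(a + 1)) := by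
  set F : ℝ := (1 + k * p.2) ^ 2 + k ^ 2 * ‖p.1‖ ^ 2 with hF
  have hkt : 0 ≤ k * p.2 := by positivity
  have hkρ : 0 < k ^ 2 * ρ ^ 2 := by positivity
  have hFge : k ^ 2 * ρ ^ 2 ≤ F := by
    have := mul_le_mul_of_nonneg_left hpρ (sq_nonneg k)
    nlinarith
  have hF0 : 0 < F := lt_of_lt_of_le hkρ hFge
  let L : E × ℝ →L[ℝ] ℝ := (2 * (1 + k * p.2) * k) • ContinuousLinearMap.snd ℝ E ℝ +
    (k ^ 2 * 2) • (innerSL ℝ p.1).comp (ContinuousLinearMap.fst ℝ E ℝ)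
  have h1 : HasFDerivAt (fun p : E × ℝ => (1 + k * p.2) ^ 2 + k ^ 2 * ‖p.1‖ ^ 2) L p := by
    have e1 : HasFDerivAt (fun p : E × ℝ => p.2) (ContinuousLinearMap.snd ℝ E ℝ) p :=
      hasFDerivAt_snd
    have e2 : HasFDerivAt (fun p : E × ℝ => p.1) (ContinuousLinearMap.fst ℝ E ℝ) p :=
      hasFDerivAt_fst
    have e3 := ((e1.const_mul k).const_add 1).pow 2
    have e4 := (e2.norm_sq).const_mul (k ^ 2)
    refine (e3.add e4).congr_fderiv ?_
    ext v
    · simp [L]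
      ring
    · simp [L]
      left
      ring
  have h2 : HasFDerivAt
      (fun p : E × ℝ => A * ((1 + k * p.2) ^ 2 + k ^ 2 * ‖p.1‖ ^ 2) ^ (-(a / 2)))
      (A • ((-(a / 2) * F ^ (-(a / 2) - 1)) • L)) p :=
    (h1.rpow_const (Or.inl hF0.ne')).const_mul A
  rw [h2.fderiv]
  have hs : 1 + k * p.2 ≤ √F := Real.le_sqrt_of_sq_le (by rw [hF]; nlinarith [sq_nonneg (k * ‖p.1‖)])
  have hs2 : k * ‖p.1‖ ≤ √F := Real.le_sqrt_of_sq_le (by rw [hF]; nlinarith [sq_nonneg (1 + k * p.2)])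
  have hL : ‖L‖ ≤ 4 * k * √F := by
    refine ContinuousLinearMap.opNorm_le_bound _ (by positivity) fun v => ?_
    have hv1 : ‖v.1‖ ≤ ‖v‖ := norm_fst_le v
    have hv2 : ‖v.2‖ ≤ ‖v‖ := norm_snd_le v
    have hin : ‖inner ℝ p.1 v.1‖ ≤ ‖p.1‖ * ‖v.1‖ := norm_inner_le_norm _ _
    have hLv : L v = (2 * (1 + k * p.2) * k) * v.2 + (k ^ 2 * 2) * inner ℝ p.1 v.1 := by
      simp [L]
    rw [hLv]
    calc _ ≤ ‖(2 * (1 + k * p.2) * k) * v.2‖ + ‖(k ^ 2 * 2) * inner ℝ p.1 v.1‖ := norm_add_le _ _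
      _ = 2 * k * ((1 + k * p.2) * ‖v.2‖) + 2 * k * (k * ‖inner ℝ p.1 v.1‖) := by
        rw [norm_mul _ v.2, norm_mul _ (inner ℝ p.1 v.1), Real.norm_of_nonneg (by positivity : 0 ≤ 2 * (1 + k * p.2) * k),
          Real.norm_of_nonneg (by positivity : 0 ≤ k ^ 2 * 2)]
        ring
      _ ≤ 2 * k * (√F * ‖v‖) + 2 * k * (√F * ‖v‖) := by
        have q1 : (1 + k * p.2) * ‖v.2‖ ≤ √F * ‖v‖ := by gcongr
        have q2 : k * ‖inner ℝ p.1 v.1‖ ≤ √F * ‖v‖ := by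
          calc _ ≤ k * (‖p.1‖ * ‖v.1‖) := by gcongr
            _ = (k * ‖p.1‖) * ‖v.1‖ := by ring
            _ ≤ _ := by gcongr
        gcongr
      _ = _ := by ring
  have hpow : (F ^ (-(a / 2) - 1)) ^ 2 * F = F ^ (-(a + 1)) := by
    rw [← Real.rpow_natCast, ← Real.rpow_mul hF0.le]
    nth_rewrite 2 [← Real.rpow_one F]
    rw [← Real.rpow_add hF0]
    congr 1
    push_cast
    ring
  have hmono : F ^ (-(a + 1)) ≤ (k ^ 2 * ρ ^ 2) ^ (-(a + 1)) :=
    Real.rpow_le_rpow_of_nonpos hkρ hFge (by linarith)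
  have hn1 : ‖A • ((-(a / 2) * F ^ (-(a / 2) - 1)) • L)‖ ≤
      |A| * (|-(a / 2) * F ^ (-(a / 2) - 1)| * (4 * k * √F)) := by
    refine (ContinuousLinearMap.opNorm_smul_le _ _).trans ?_
    refine mul_le_mul_of_nonneg_left ?_ (abs_nonneg A)
    refine (ContinuousLinearMap.opNorm_smul_le _ _).trans ?_
    exact mul_le_mul_of_nonneg_left hL (abs_nonneg _)
  calc _ ≤ (|A| * (|-(a / 2) * F ^ (-(a / 2) - 1)| * (4 * k * √F))) ^ 2 :=
        pow_le_pow_left₀ (ContinuousLinearMap.opNorm_nonneg _) hn1 2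
    _ = A ^ 2 * ((-(a / 2) * F ^ (-(a / 2) - 1)) ^ 2 * (4 * k * √F) ^ 2) := by
      rw [mul_pow, mul_pow, sq_abs, sq_abs]
    _ = 4 * a ^ 2 * A ^ 2 * k ^ 2 * ((F ^ (-(a / 2) - 1)) ^ 2 * √F ^ 2) := by ring
    _ = 4 * a ^ 2 * A ^ 2 * k ^ 2 * F ^ (-(a + 1)) := by rw [Real.sq_sqrt hF0.le, hpow]
    _ ≤ _ := by gcongr

theorem wModel_gradient_annulus_estimate (m : ℝ) (hm : 0 < m) (n : ℕ) (hn : 3 ≤ n) :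
    ∃ C : ℝ, 0 < C ∧ ∀ ε : ℝ, 0 < ε → ε ≤ 1 → ∀ τ : ℝ, 0 < τ → τ ≤ cmn m n * ε ^ 2 →
      (∫ p in {p : EuclideanSpace ℝ (Fin (n - 1)) × ℝ | 0 ≤ p.2 ∧
            ε ≤ Real.sqrt (‖p.1‖ ^ 2 + p.2 ^ 2) ∧ Real.sqrt (‖p.1‖ ^ 2 + p.2 ^ 2) ≤ 2 * ε},
          ‖fderiv ℝ (wModel m n 0 τ) p‖ ^ 2) ≤
        C * ε ^ (2 - (n : ℝ) - 2 * m) *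
          τ ^ (((n : ℝ) - 1) / (2 * (m + n - 1)) + m + ((n : ℝ) - 3) / 2) := by
  have hn' : (3 : ℝ) ≤ n := by exact_mod_cast hn
  have ha : 0 < m + n - 2 := by linarith
  have hb : 0 < m + n - 1 := by linarith
  have hc : 0 < cmn m n := by unfold cmn; positivity
  set a : ℝ := m + n - 2 with ha_def
  set c := cmn m n with hc_def
  set V : ℝ := (volume : Measure (EuclideanSpace ℝ (Fin (n - 1)) × ℝ)).real
    (Metric.ball 0 1) with hV
  have hV0 : 0 ≤ V := measureReal_nonneg
  refine ⟨4 * a ^ 2 * c ^ (-a) * 2 ^ n * (V + 1), by positivity, ?_⟩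
  intro ε hε _ τ hτ _
  set k : ℝ := (c / τ) ^ ((1 : ℝ) / 2) with hk_def
  have hcτ : 0 < c / τ := by positivity
  have hk : 0 < k := by positivity
  have hk2 : k ^ 2 = c / τ := by
    rw [hk_def, ← Real.sqrt_eq_rpow, Real.sq_sqrt hcτ.le]
  set A : ℝ := τ ^ (-(((n : ℝ) - 1) * a) / (4 * (m + n - 1))) with hA
  have hw : wModel m n 0 τ = fun p =>
      A * ((1 + k * p.2) ^ 2 + k ^ 2 * ‖p.1‖ ^ 2) ^ (-(a / 2)) := by
    funext p
    rw [hk2]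
    simp only [wModel, sub_zero, A, k, a, c]
    congr 3
    ring
  set S := {p : EuclideanSpace ℝ (Fin (n - 1)) × ℝ | 0 ≤ p.2 ∧
            ε ≤ Real.sqrt (‖p.1‖ ^ 2 + p.2 ^ 2) ∧ Real.sqrt (‖p.1‖ ^ 2 + p.2 ^ 2) ≤ 2 * ε} with hS
  have hsub : S ⊆ Metric.closedBall 0 (2 * ε) := by
    rintro p ⟨h0, -, h2⟩
    rw [mem_closedBall_zero_iff, Prod.norm_def]
    refine max_le (le_trans (Real.le_sqrt_of_sq_le ?_) h2) (le_trans (Real.le_sqrt_of_sq_le ?_) h2)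
    · nlinarith [sq_nonneg p.2]
    · rw [Real.norm_eq_abs, sq_abs]; nlinarith [sq_nonneg ‖p.1‖]
  have hfin : volume (Metric.closedBall (0 : EuclideanSpace ℝ (Fin (n - 1)) × ℝ) (2 * ε)) < ⊤ :=
    measure_closedBall_lt_top
  have hvol : (volume : Measure (EuclideanSpace ℝ (Fin (n - 1)) × ℝ)).real S ≤
      (2 * ε) ^ n * V := by
    refine (measureReal_mono hsub hfin.ne).trans (le_of_eq ?_)
    have : (volume : Measure (EuclideanSpace ℝ (Fin (n - 1)) × ℝ)).IsAddHaarMeasure :=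
      Measure.prod.instIsAddHaarMeasure _ _
    rw [Measure.addHaar_real_closedBall _ _ (by positivity)]
    congr 2
    simp
    omega
  set B : ℝ := 4 * a ^ 2 * A ^ 2 * k ^ 2 * (k ^ 2 * ε ^ 2) ^ (-(a + 1)) with hB
  have hB0 : 0 ≤ B := by positivity
  have hint : ‖∫ p in S, ‖fderiv ℝ (wModel m n 0 τ) p‖ ^ 2‖ ≤ B * volume.real S := by
    refine norm_setIntegral_le_of_norm_le_const ((measure_mono hsub).trans_lt hfin) ?_
    rintro p ⟨h0, h1, -⟩
    rw [Real.norm_of_nonneg (by positivity), hw]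
    exact grad_bound_aux A k a ε hk ha hε p h0 ((Real.le_sqrt' hε).1 h1)
  have hτe : A ^ 2 * τ ^ a =
      τ ^ (((n : ℝ) - 1) / (2 * (m + n - 1)) + m + ((n : ℝ) - 3) / 2) := by
    rw [hA, ← Real.rpow_natCast, ← Real.rpow_mul hτ.le, ← Real.rpow_add hτ]
    congr 1
    rw [ha_def]
    push_cast
    field_simp
    ring
  have hεe : (ε ^ 2) ^ (-(a + 1)) * ε ^ n = ε ^ (2 - (n : ℝ) - 2 * m) := by
    rw [← Real.rpow_natCast ε n, ← Real.rpow_natCast ε 2, ← Real.rpow_mul hε.le, ← Real.rpow_add hε]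
    congr 1
    rw [ha_def]
    push_cast
    ring
  have hke : k ^ 2 * (k ^ 2) ^ (-(a + 1)) = c ^ (-a) * τ ^ a := by
    have hk2p : 0 < k ^ 2 := by positivity
    nth_rewrite 1 [← Real.rpow_one (k ^ 2)]
    rw [← Real.rpow_add hk2p, hk2, show 1 + -(a + 1) = -a by ring, Real.div_rpow hc.le hτ.le,
      Real.rpow_neg hτ.le, div_inv_eq_mul]
  calc _ ≤ B * volume.real S := (Real.le_norm_self _).trans hint
    _ ≤ B * ((2 * ε) ^ n * V) := by gcongr
    _ ≤ B * ((2 * ε) ^ n * (V + 1)) := by gcongr; linarith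
    _ = 4 * a ^ 2 * 2 ^ n * (V + 1) * (A ^ 2) * (k ^ 2 * (k ^ 2) ^ (-(a + 1))) *
        ((ε ^ 2) ^ (-(a + 1)) * ε ^ n) := by
      rw [hB, Real.mul_rpow (by positivity) (by positivity)]
      ring
    _ = _ := by
      rw [hke, hεe, ← hτe]
      ring
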